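/- Consider the two-timescale iteration x_{k+1} = x_k + a_k (f(x_k, p_k) − x_k), p_{k+1} = p_k + β_k ∇Φ(x_k)·1{p_k + β_k ∇Φ(x_k) ∈ 𝒫_c}, started at (x₀, p₀) ∈ 𝒳 × 𝒫_c with 0 < c < c*. Under the standing assumptions on G₀ and Φ, assume: f : ℝⁿ × ℝⁿ → ℝⁿ maps 𝒳 × 𝒫_c into 𝒳 and is jointly L_f-Lipschitz there; there is a class-𝒦ℒ function φ such that for every p ∈ 𝒫_c, every solution x(t) of ẋ = f(x, p) − x with x(0) ∈ 𝒳 satisfies ‖x(t) − x*(p)‖ ≤ φ(‖x(0) − x*(p)‖, t) for all t ≥ 0; and the step sizes satisfy a_k ∈ (0,1], β_k > 0, Σ_k a_k = Σ_k β_k = ∞, Σ_k (a_k² + β_k²) < ∞, and β_k / a_k → 0. Then ‖x_k − x*(p_k)‖ → 0 as k → ∞. -/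

import Mathlib

open scoped RealInnerProductSpace
open Filter Topology

/-- Symmetrization `(T + Tᵀ)/2` of a continuous linear map on Euclidean space. -/
noncomputable def symCLM {n : ℕ}
    (T : EuclideanSpace ℝ (Fin n) →L[ℝ] EuclideanSpace ℝ (Fin n)) :
    EuclideanSpace ℝ (Fin n) →L[ℝ] EuclideanSpace ℝ (Fin n) :=
  (1 / 2 : ℝ) • (T + ContinuousLinearMap.adjoint T)

/-- A function `φ : [0,∞) × [0,∞) → [0,∞)` of class 𝒦ℒ. -/
def IsClassKL (φ : ℝ → ℝ → ℝ) : Prop :=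
  (∀ r t, 0 ≤ r → 0 ≤ t → 0 ≤ φ r t) ∧
  (∀ t, 0 ≤ t →
    ContinuousOn (fun r => φ r t) (Set.Ici 0) ∧
    StrictMonoOn (fun r => φ r t) (Set.Ici 0) ∧ φ 0 t = 0) ∧
  (∀ r, 0 ≤ r →
    AntitoneOn (fun t => φ r t) (Set.Ici 0) ∧
    Filter.Tendsto (fun t => φ r t) Filter.atTop (nhds 0))

/-- A time-dependent vector field which is globally Lipschitz in space, continuous in time and
bounded on bounded time intervals has a solution defined for all times. -/
theorem exists_forall_hasDerivAt_of_lipschitzWith {E : Type*} [NormedAddCommGroup E]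
    [NormedSpace ℝ E] [CompleteSpace E] {v : ℝ → E → E} {K : NNReal}
    (hK : ∀ t, LipschitzWith K (v t)) (hcont : ∀ y, Continuous fun t => v t y)
    (hbdd : ∀ T : ℝ, ∃ C : NNReal, ∀ t ∈ Set.Icc (-T) T, ∀ y, ‖v t y‖ ≤ C) (y₀ : E) :
    ∃ y : ℝ → E, y 0 = y₀ ∧ ∀ t, HasDerivAt y (v t (y t)) t := by
  have hlocal : ∀ N : ℕ, ∃ y : ℝ → E, y 0 = y₀ ∧
      ∀ t ∈ Set.Ioo (-(N + 1 : ℝ)) (N + 1), HasDerivAt y (v t (y t)) t := by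
    intro N
    obtain ⟨C, hC⟩ := hbdd (N + 1)
    have h0 : (0 : ℝ) ∈ Set.Icc (-(N + 1 : ℝ)) (N + 1) := ⟨by linarith, by positivity⟩
    have hPL : IsPicardLindelof v (⟨0, h0⟩ : Set.Icc (-(N + 1 : ℝ)) (N + 1)) y₀
        (C * (N + 1)) 0 C K :=
      { lipschitzOnWith := fun t _ => (hK t).lipschitzOnWith
        continuousOn := fun y _ => (hcont y).continuousOn
        norm_le := fun t ht y _ => hC t ht y
        mul_max_le := by simp }
    obtain ⟨y, hy0, hy⟩ := hPL.exists_eq_forall_mem_Icc_hasDerivWithinAt₀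
    exact ⟨y, hy0, fun t ht => (hy t (Set.Ioo_subset_Icc_self ht)).hasDerivAt
      (Icc_mem_nhds ht.1 ht.2)⟩
  choose y hy0 hy using hlocal
  have hagree : ∀ M N : ℕ, M ≤ N → Set.EqOn (y M) (y N) (Set.Ioo (-(M + 1 : ℝ)) (M + 1)) := by
    intro M N hMN
    have hMN' : (M : ℝ) ≤ N := Nat.cast_le.2 hMN
    refine ODE_solution_unique_of_mem_Ioo (v := v) (s := fun _ => Set.univ) (t₀ := 0) (K := K)
      (fun t _ => (hK t).lipschitzOnWith) ⟨by linarith, by positivity⟩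
      (fun t ht => ⟨hy M t ht, trivial⟩) (fun t ht => ⟨hy N t ?_, trivial⟩)
      ((hy0 M).trans (hy0 N).symm)
    exact ⟨by linarith [ht.1], by linarith [ht.2]⟩
  refine ⟨fun t => y ⌈|t|⌉₊ t, by simp [hy0], fun t => ?_⟩
  have hmem : ∀ s : ℝ, s ∈ Set.Ioo (-(⌈|s|⌉₊ + 1 : ℝ)) (⌈|s|⌉₊ + 1) := fun s => by
    rw [Set.mem_Ioo, ← abs_lt]
    linarith [Nat.le_ceil |s|]
  refine (hy _ t (hmem t)).congr_of_eventuallyEq ?_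
  filter_upwards [Ioo_mem_nhds (hmem t).1 (hmem t).2] with s hs
  rcases le_total ⌈|s|⌉₊ ⌈|t|⌉₊ with h | h
  · exact hagree _ _ h (hmem s)
  · exact (hagree _ _ h hs).symm

/-- The projection of Euclidean space onto a box, and its basic properties. -/
theorem exists_lipschitzWith_retraction_box {n : ℕ} {a b : Fin n → ℝ} (hab : ∀ i, a i ≤ b i) :
    ∃ π : EuclideanSpace ℝ (Fin n) → EuclideanSpace ℝ (Fin n), LipschitzWith 1 π ∧
      (∀ x i, π x i ∈ Set.Icc (a i) (b i)) ∧ ∀ x, (∀ i, x i ∈ Set.Icc (a i) (b i)) → π x = x := by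
  refine ⟨fun x => WithLp.toLp 2 fun i => max (a i) (min (b i) (x i)), ?_, ?_, ?_⟩
  · refine LipschitzWith.of_dist_le_mul fun x y => ?_
    rw [NNReal.coe_one, one_mul, EuclideanSpace.dist_eq, EuclideanSpace.dist_eq]
    gcongr with i
    simp only [Real.dist_eq]
    refine (abs_max_sub_max_le_max _ _ _ _).trans (max_le (by simp) ?_)
    exact (abs_min_sub_min_le_max _ _ _ _).trans (max_le (by simp) le_rfl)
  · exact fun x i => ⟨le_max_left _ _, max_le (hab i) (min_le_left _ _)⟩
  · intro x hx
    ext i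
    simp [(hx i).1, (hx i).2]

/-- A Lipschitz map of a box into itself generates a flow `ξ' = F ξ - ξ` staying in the box. -/
theorem exists_forall_hasDerivAt_box {n : ℕ} {a b : Fin n → ℝ}
    {F : EuclideanSpace ℝ (Fin n) → EuclideanSpace ℝ (Fin n)} {K : NNReal}
    (hF : ∀ x : EuclideanSpace ℝ (Fin n), (∀ i, x i ∈ Set.Icc (a i) (b i)) →
      ∀ i, F x i ∈ Set.Icc (a i) (b i))
    (hlip : LipschitzOnWith K F {x | ∀ i, x i ∈ Set.Icc (a i) (b i)})
    (hbdd : Bornology.IsBounded {x : EuclideanSpace ℝ (Fin n) | ∀ i, x i ∈ Set.Icc (a i) (b i)})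
    {x₀ : EuclideanSpace ℝ (Fin n)} (hx₀ : ∀ i, x₀ i ∈ Set.Icc (a i) (b i)) :
    ∃ ξ : ℝ → EuclideanSpace ℝ (Fin n), ξ 0 = x₀ ∧
      (∀ t, 0 ≤ t → ∀ i, ξ t i ∈ Set.Icc (a i) (b i)) ∧
      ∀ t, 0 ≤ t → HasDerivAt ξ (F (ξ t) - ξ t) t := by
  obtain ⟨π, hπlip, hπmem, hπ⟩ :=
    exists_lipschitzWith_retraction_box fun i => (hx₀ i).1.trans (hx₀ i).2
  have hFπ : LipschitzWith K (F ∘ π) := by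
    rw [← lipschitzOnWith_univ]
    simpa only [mul_one] using
      hlip.comp (hπlip.lipschitzOnWith (s := Set.univ)) fun x _ => hπmem x
  obtain ⟨C, hC⟩ := hbdd.exists_norm_le
  have hFC : ∀ x, ‖F (π x)‖ ≤ C := fun x => hC _ (hF _ (hπmem x))
  have hC0 : 0 ≤ C := (norm_nonneg _).trans (hFC 0)
  -- the substitution `y t = exp t • ξ t` makes the vector field bounded in space
  obtain ⟨y, hy0, hy⟩ := exists_forall_hasDerivAt_of_lipschitzWith
    (v := fun t y => Real.exp t • F (π (Real.exp (-t) • y))) (K := K)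
    (fun t => LipschitzWith.of_dist_le_mul fun y z => by
      have h := hFπ.dist_le_mul (Real.exp (-t) • y) (Real.exp (-t) • z)
      simp only [Function.comp_apply, dist_smul₀, Real.norm_eq_abs, Real.abs_exp] at h ⊢
      calc _ ≤ Real.exp t * (K * (Real.exp (-t) * dist y z)) := by gcongr
        _ = (Real.exp t * Real.exp (-t)) * (K * dist y z) := by ring
        _ = _ := by rw [← Real.exp_add]; simp)
    (fun y => by
      have h : Continuous fun t : ℝ => (F ∘ π) (Real.exp (-t) • y) :=
        hFπ.continuous.comp (by fun_prop)
      exact Real.continuous_exp.smul h)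
    (fun T => ⟨(Real.exp T * C).toNNReal, fun t ht y => by
      rw [norm_smul, Real.norm_eq_abs, Real.abs_exp, Real.coe_toNNReal _ (by positivity)]
      gcongr
      exacts [ht.2, hFC _]⟩) x₀
  have hξ : ∀ t, HasDerivAt (fun t => Real.exp (-t) • y t)
      (F (π (Real.exp (-t) • y t)) - Real.exp (-t) • y t) t := by
    intro t
    have h := ((Real.hasDerivAt_exp (-t)).comp t (hasDerivAt_neg t)).smul (hy t)
    refine h.congr_deriv ?_
    simp [smul_smul, ← Real.exp_add, sub_eq_add_neg]
  have hmem : ∀ t, 0 ≤ t → ∀ i, (Real.exp (-t) • y t) i ∈ Set.Icc (a i) (b i) := by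
    intro t ht i
    have hyi : ∀ s, HasDerivAt (fun s => y s i)
        (Real.exp s * F (π (Real.exp (-s) • y s)) i) s := fun s =>
      (EuclideanSpace.proj (𝕜 := ℝ) i).hasFDerivAt.comp_hasDerivAt s (hy s)
    have hFi := fun s => hF _ (hπmem (Real.exp (-s) • y s)) i
    have hlow : Monotone fun s => y s i - a i * Real.exp s :=
      monotone_of_hasDerivAt_nonneg
        (fun s => (hyi s).sub ((Real.hasDerivAt_exp s).const_mul (a i)))
        (fun s => by
          simp only [Pi.zero_apply]
          nlinarith [(hFi s).1, Real.exp_pos s])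
    have hup : Monotone fun s => b i * Real.exp s - y s i :=
      monotone_of_hasDerivAt_nonneg
        (fun s => ((Real.hasDerivAt_exp s).const_mul (b i)).sub (hyi s))
        (fun s => by
          simp only [Pi.zero_apply]
          nlinarith [(hFi s).2, Real.exp_pos s])
    have h1 := hlow ht
    have h2 := hup ht
    simp only [hy0, Real.exp_zero, mul_one] at h1 h2
    have h3 := hx₀ i
    rw [PiLp.smul_apply, smul_eq_mul, Real.exp_neg, inv_mul_eq_div, Set.mem_Icc,
      le_div_iff₀ (Real.exp_pos t), div_le_iff₀ (Real.exp_pos t)]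
    constructor <;> linarith [h3.1, h3.2]
  refine ⟨fun t => Real.exp (-t) • y t, by simp [hy0], hmem, fun t ht => ?_⟩
  have h := hξ t
  rwa [hπ _ (hmem t ht)] at h

/-- A map whose derivative has symmetric part bounded below is strongly monotone. -/
theorem le_inner_sub_of_hasFDerivAt {E : Type*} [NormedAddCommGroup E] [InnerProductSpace ℝ E]
    {s : Set E} (hs : Convex ℝ s) {G : E → E} {DG : E → E →L[ℝ] E}
    (hG : ∀ x ∈ s, HasFDerivAt G (DG x) x) {c : ℝ}
    (hDG : ∀ x ∈ s, ∀ w, c * ‖w‖ ^ 2 ≤ ⟪w, DG x w⟫) {x y : E} (hx : x ∈ s) (hy : y ∈ s) :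
    c * ‖x - y‖ ^ 2 ≤ ⟪x - y, G x - G y⟫ := by
  have hseg : ∀ t ∈ Set.Icc (0 : ℝ) 1, y + t • (x - y) ∈ s := fun t ht =>
    hs.add_smul_sub_mem hy hx ht
  have hderiv : ∀ t ∈ Set.Icc (0 : ℝ) 1, HasDerivAt (fun t : ℝ => ⟪x - y, G (y + t • (x - y))⟫)
      ⟪x - y, DG (y + t • (x - y)) (x - y)⟫ t := by
    intro t ht
    have h1 : HasDerivAt (fun t : ℝ => y + t • (x - y)) (x - y) t := by
      simpa using ((hasDerivAt_id t).smul_const (x - y)).const_add y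
    exact (innerSL ℝ (x - y)).hasFDerivAt.comp_hasDerivAt t
      ((hG _ (hseg t ht)).comp_hasDerivAt t h1)
  obtain ⟨t, ht, h⟩ := exists_hasDerivAt_eq_slope _ _ zero_lt_one
    (fun t ht => (hderiv t ht).continuousAt.continuousWithinAt)
    (fun t ht => hderiv t (Set.Ioo_subset_Icc_self ht))
  have h2 := hDG _ (hseg t (Set.Ioo_subset_Icc_self ht)) (x - y)
  rw [h] at h2
  simpa [inner_sub_right] using h2

theorem inner_symCLM_self {n : ℕ} (T : EuclideanSpace ℝ (Fin n) →L[ℝ] EuclideanSpace ℝ (Fin n))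
    (w : EuclideanSpace ℝ (Fin n)) : ⟪w, symCLM T w⟫ = ⟪w, T w⟫ := by
  rw [symCLM, smul_apply, add_apply, inner_smul_right,
    inner_add_right, ContinuousLinearMap.adjoint_inner_right, real_inner_comm w (T w)]
  ring

/-- Local error of the explicit Euler scheme for `ξ' = F ξ - ξ`. -/
theorem norm_sub_euler_step_le {E : Type*} [NormedAddCommGroup E] [NormedSpace ℝ E] {X : Set E}
    {D L : ℝ} (hL : 0 ≤ L) (hD : ∀ x ∈ X, ∀ y ∈ X, ‖x - y‖ ≤ D) {F : E → E}
    (hFX : ∀ x ∈ X, F x ∈ X) (hF : ∀ x ∈ X, ∀ y ∈ X, ‖F x - F y‖ ≤ L * ‖x - y‖) {ξ : ℝ → E}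
    (hξX : ∀ t, 0 ≤ t → ξ t ∈ X) (hξ : ∀ t, 0 ≤ t → HasDerivAt ξ (F (ξ t) - ξ t) t)
    {s h : ℝ} (hs : 0 ≤ s) (hh : 0 ≤ h) :
    ‖ξ (s + h) - ξ s - h • (F (ξ s) - ξ s)‖ ≤ (L + 1) * D * h ^ 2 := by
  have hD0 : 0 ≤ D := (norm_nonneg _).trans (hD _ (hξX s hs) _ (hξX s hs))
  have hlip : ∀ t ∈ Set.Icc s (s + h), ‖ξ t - ξ s‖ ≤ D * (t - s) :=
    norm_image_sub_le_of_norm_deriv_le_segment'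
      (fun t ht => (hξ t (hs.trans ht.1)).hasDerivWithinAt)
      fun t ht => hD _ (hFX _ (hξX t (hs.trans ht.1))) _ (hξX t (hs.trans ht.1))
  have key := norm_image_sub_le_of_norm_deriv_le_segment' (a := s) (b := s + h)
    (f := fun t => ξ t - t • (F (ξ s) - ξ s)) (C := (L + 1) * (D * h))
    (fun t ht => ((hξ t (hs.trans ht.1)).sub
      ((hasDerivAt_id t).smul_const (F (ξ s) - ξ s))).hasDerivWithinAt)
    (fun t ht => by
      have hX := hξX t (hs.trans ht.1)
      have h1 := hF _ hX _ (hξX s hs)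
      have h2 : ‖ξ t - ξ s‖ ≤ D * h := (hlip t (Set.Ico_subset_Icc_self ht)).trans
        (by gcongr; linarith [ht.2])
      calc ‖F (ξ t) - ξ t - (1 : ℝ) • (F (ξ s) - ξ s)‖
          = ‖(F (ξ t) - F (ξ s)) - (ξ t - ξ s)‖ := by rw [one_smul]; congr 1; abel
        _ ≤ ‖F (ξ t) - F (ξ s)‖ + ‖ξ t - ξ s‖ := norm_sub_le _ _
        _ ≤ (L + 1) * ‖ξ t - ξ s‖ := by linarith
        _ ≤ (L + 1) * (D * h) := by gcongr)
    (s + h) (Set.right_mem_Icc.2 (by linarith))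
  calc _ = ‖ξ (s + h) - (s + h) • (F (ξ s) - ξ s) - (ξ s - s • (F (ξ s) - ξ s))‖ := by
        congr 1; rw [add_smul]; abel
    _ ≤ _ := key
    _ = _ := by ring

/-- A discrete Grönwall inequality. -/
theorem le_mul_exp_of_le_one_add_mul {e α : ℕ → ℝ} {L δ : ℝ} {N : ℕ} (hα : ∀ j, 0 ≤ α j)
    (hL : 0 ≤ L) (hδ : 0 ≤ δ) (he0 : e 0 ≤ 0)
    (he : ∀ j < N, e (j + 1) ≤ (1 + L * α j) * e j + δ * α j) :
    ∀ j ≤ N, e j ≤ δ * (∑ i ∈ Finset.range j, α i) *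
      Real.exp (L * ∑ i ∈ Finset.range j, α i) := by
  intro j
  induction j with
  | zero => simpa using he0
  | succ j ih =>
    intro hj
    have hS : 0 ≤ ∑ i ∈ Finset.range j, α i := Finset.sum_nonneg fun i _ => hα i
    have hSj := hα j
    rw [Finset.sum_range_succ]
    set S := ∑ i ∈ Finset.range j, α i
    have h1 : 1 + L * α j ≤ Real.exp (L * α j) := by linarith [Real.add_one_le_exp (L * α j)]
    have h2 : 1 ≤ Real.exp (L * (S + α j)) := Real.one_le_exp (by positivity)
    calc e (j + 1) ≤ (1 + L * α j) * e j + δ * α j := he j hj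
      _ ≤ (1 + L * α j) * (δ * S * Real.exp (L * S)) + δ * α j := by
        gcongr; exact ih (by omega)
      _ ≤ Real.exp (L * α j) * (δ * S * Real.exp (L * S)) +
          δ * α j * Real.exp (L * (S + α j)) :=
        add_le_add (by gcongr) (le_mul_of_one_le_right (by positivity) h2)
      _ = δ * (S + α j) * Real.exp (L * (S + α j)) := by rw [mul_add L, Real.exp_add]; ring

/-- A perturbed Euler scheme with steps at most `η` and perturbation at most `B * η` stays close
to the trajectory of `ξ' = F ξ - ξ` with the same initial value. -/
theorem norm_sub_perturbed_euler_le {E : Type*} [NormedAddCommGroup E] [NormedSpace ℝ E]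
    {X : Set E} {D L B η : ℝ} (hL : 0 ≤ L) (hB : 0 ≤ B) (hη : 0 ≤ η)
    (hD : ∀ x ∈ X, ∀ y ∈ X, ‖x - y‖ ≤ D) {F : E → E}
    (hFX : ∀ x ∈ X, F x ∈ X) (hF : ∀ x ∈ X, ∀ y ∈ X, ‖F x - F y‖ ≤ L * ‖x - y‖) {ξ : ℝ → E}
    (hξX : ∀ t, 0 ≤ t → ξ t ∈ X) (hξ : ∀ t, 0 ≤ t → HasDerivAt ξ (F (ξ t) - ξ t) t)
    {x u : ℕ → E} {α : ℕ → ℝ} {N : ℕ} (hxX : ∀ j, x j ∈ X) (hx0 : x 0 = ξ 0)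
    (hx : ∀ j, x (j + 1) = x j + α j • (u j - x j)) (hα : ∀ j, 0 ≤ α j)
    (hαη : ∀ j, α j ≤ η) (hu : ∀ j < N, ‖u j - F (x j)‖ ≤ B * η) :
    ‖x N - ξ (∑ i ∈ Finset.range N, α i)‖ ≤
      (B + (L + 1) * D) * η * (∑ i ∈ Finset.range N, α i) *
        Real.exp ((L + 1) * ∑ i ∈ Finset.range N, α i) := by
  have hD0 : 0 ≤ D := (norm_nonneg _).trans (hD _ (hxX 0) _ (hxX 0))
  refine le_mul_exp_of_le_one_add_mul (e := fun j => ‖x j - ξ (∑ i ∈ Finset.range j, α i)‖)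
    hα (by positivity) (by positivity) (by simp [hx0]) (fun j hj => ?_) N le_rfl
  have hS : 0 ≤ ∑ i ∈ Finset.range j, α i := Finset.sum_nonneg fun i _ => hα i
  simp only [Finset.sum_range_succ, hx]
  set S := ∑ i ∈ Finset.range j, α i
  have hα0 := hα j
  have hstep := norm_sub_euler_step_le hL hD hFX hF hξX hξ hS hα0
  have hFx := hF _ (hxX j) _ (hξX S hS)
  have huj := hu j hj
  set w := ξ (S + α j) - ξ S - α j • (F (ξ S) - ξ S)
  have hdecomp : x j + α j • (u j - x j) - ξ (S + α j) =
      (x j - ξ S) + α j • ((u j - F (x j)) + (F (x j) - F (ξ S)) - (x j - ξ S)) - w := by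
    simp only [w]
    module
  calc _ = _ := congrArg norm hdecomp
    _ ≤ ‖x j - ξ S‖ + α j * (‖u j - F (x j)‖ + ‖F (x j) - F (ξ S)‖ + ‖x j - ξ S‖) + ‖w‖ := by
      refine (norm_sub_le _ _).trans (add_le_add_left ((norm_add_le _ _).trans ?_) _)
      rw [norm_smul, Real.norm_of_nonneg hα0]
      gcongr
      exact (norm_sub_le _ _).trans (add_le_add_left (norm_add_le _ _) _)
    _ ≤ ‖x j - ξ S‖ + α j * (B * η + L * ‖x j - ξ S‖ + ‖x j - ξ S‖) +
        (L + 1) * D * (η * α j) := by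
      gcongr
      refine hstep.trans ?_
      rw [sq]
      gcongr
      exact hαη j
    _ = _ := by ring

/-- If the partial sums of `α ∈ (0, 1]` diverge, then every late index closes a window of length
between `T` and `T + 1` which starts late. -/
theorem eventually_exists_sum_mem_Icc {α : ℕ → ℝ} (hα : ∀ k, α k ∈ Set.Ioc (0 : ℝ) 1)
    (hsum : Tendsto (fun N => ∑ k ∈ Finset.range N, α k) atTop atTop) (K : ℕ) {T : ℝ}
    (hT : 0 < T) :
    ∀ᶠ j in atTop, ∃ k N, K ≤ k ∧ j = k + N ∧
      ∑ i ∈ Finset.range N, α (k + i) ∈ Set.Icc T (T + 1) := by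
  filter_upwards [hsum.eventually_ge_atTop (T + ∑ k ∈ Finset.range K, α k),
    eventually_ge_atTop K] with j hj hKj
  classical
  let P : ℕ → Prop := fun k => T + ∑ i ∈ Finset.range k, α i ≤ ∑ i ∈ Finset.range j, α i
  set k := Nat.findGreatest P j
  have hk : P k := Nat.findGreatest_spec hKj hj
  have hkj : k < j := by
    refine lt_of_le_of_ne (Nat.findGreatest_le j) fun h => ?_
    have hk' := hk
    simp only [P, h] at hk'
    linarith
  have hk1 : ¬ P (k + 1) := Nat.findGreatest_is_greatest (Nat.lt_succ_self k) hkj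
  have hsplit := Finset.sum_range_add α k (j - k)
  rw [Nat.add_sub_cancel' hkj.le] at hsplit
  simp only [P, Finset.sum_range_succ, not_le] at hk hk1
  refine ⟨k, j - k, Nat.le_findGreatest hKj hj, by omega, ?_, ?_⟩ <;> linarith [(hα k).2]

theorem stmt12 {n : ℕ} (a b : Fin n → ℝ) (hab : ∀ i, a i < b i)
    (𝒳 : Set (EuclideanSpace ℝ (Fin n)))
    (h𝒳 : 𝒳 = {x : EuclideanSpace ℝ (Fin n) | ∀ i, x i ∈ Set.Icc (a i) (b i)})
    (G₀ : EuclideanSpace ℝ (Fin n) → EuclideanSpace ℝ (Fin n))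
    (DG₀ : EuclideanSpace ℝ (Fin n) →
      EuclideanSpace ℝ (Fin n) →L[ℝ] EuclideanSpace ℝ (Fin n))
    (U : Set (EuclideanSpace ℝ (Fin n))) (hU : IsOpen U) (hXU : 𝒳 ⊆ U)
    (hG₀ : ∀ x ∈ U, HasFDerivAt G₀ (DG₀ x) x)
    (m : ℝ) (hm : 0 < m)
    (hsym : ∀ x ∈ 𝒳, ∀ w, ⟪w, symCLM (DG₀ x) w⟫ ≥ m / 2 * ‖w‖ ^ 2)
    -- `x*` is the response map: the inverse of `x ↦ −G₀(x)` from `int 𝒳` onto `𝒫`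
    (xstar : EuclideanSpace ℝ (Fin n) → EuclideanSpace ℝ (Fin n))
    (hmaps : Set.MapsTo xstar ((fun x => -G₀ x) '' interior 𝒳) (interior 𝒳))
    (hinv₁ : ∀ p ∈ (fun x => -G₀ x) '' interior 𝒳, G₀ (xstar p) = -p)
    (hinv₂ : ∀ x ∈ interior 𝒳, xstar (-G₀ x) = x)
    -- the planner's social cost `Φ`
    (Φ : EuclideanSpace ℝ (Fin n) → ℝ)
    (gradΦ : EuclideanSpace ℝ (Fin n) → EuclideanSpace ℝ (Fin n))
    (hΦ : ∀ x, HasGradientAt Φ (gradΦ x) x)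
    (μΦ : ℝ) (hμΦ : 0 < μΦ) (hΦconv : StrongConvexOn 𝒳 μΦ Φ)
    (L₂ : NNReal) (hΦlip : LipschitzOnWith L₂ gradΦ 𝒳)
    (xdag : EuclideanSpace ℝ (Fin n)) (hxdag : xdag ∈ interior 𝒳)
    (hmin : ∀ x ∈ 𝒳, Φ xdag ≤ Φ x)
    -- the sublevel set `𝒫_c` with `0 < c < c*`
    (c : ℝ) (hc0 : 0 < c) (hcstar : c < sInf ((fun x => Φ x - Φ xdag) '' frontier 𝒳))
    (Pc : Set (EuclideanSpace ℝ (Fin n)))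
    (hPc : Pc = {p ∈ (fun x => -G₀ x) '' interior 𝒳 | Φ (xstar p) - Φ xdag ≤ c})
    -- the agents' learning dynamics `f`
    (f : EuclideanSpace ℝ (Fin n) → EuclideanSpace ℝ (Fin n) → EuclideanSpace ℝ (Fin n))
    (hfmaps : ∀ x ∈ 𝒳, ∀ p ∈ Pc, f x p ∈ 𝒳)
    (Lf : NNReal)
    (hflip : LipschitzOnWith Lf
      (fun q : EuclideanSpace ℝ (Fin n) × EuclideanSpace ℝ (Fin n) => f q.1 q.2) (𝒳 ×ˢ Pc))
    (φ : ℝ → ℝ → ℝ) (hφ : IsClassKL φ)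
    (hKL : ∀ p ∈ Pc, ∀ ξ : ℝ → EuclideanSpace ℝ (Fin n), ξ 0 ∈ 𝒳 →
      (∀ t : ℝ, 0 ≤ t → HasDerivAt ξ (f (ξ t) p - ξ t) t) →
      ∀ t : ℝ, 0 ≤ t → ‖ξ t - xstar p‖ ≤ φ ‖ξ 0 - xstar p‖ t)
    -- step sizes
    (ak βk : ℕ → ℝ) (hak : ∀ k, ak k ∈ Set.Ioc (0 : ℝ) 1) (hbk : ∀ k, 0 < βk k)
    (haksum : Tendsto (fun N => ∑ k ∈ Finset.range N, ak k) atTop atTop)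
    (hbksum : Tendsto (fun N => ∑ k ∈ Finset.range N, βk k) atTop atTop)
    (hsq : Summable (fun k => ak k ^ 2 + βk k ^ 2))
    (hratio : Tendsto (fun k => βk k / ak k) atTop (𝓝 0))
    -- the two-timescale iteration
    (x p : ℕ → EuclideanSpace ℝ (Fin n)) (hx0 : x 0 ∈ 𝒳) (hp0 : p 0 ∈ Pc)
    (hxrec : ∀ k, x (k + 1) = x k + ak k • (f (x k) (p k) - x k))
    (hprec : ∀ k, p (k + 1) = p k +
      Set.indicator Pc (fun _ => βk k • gradΦ (x k)) (p k + βk k • gradΦ (x k))) :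
    Tendsto (fun k => ‖x k - xstar (p k)‖) atTop (𝓝 0) := by
  have hbdd : Bornology.IsBounded
      {x : EuclideanSpace ℝ (Fin n) | ∀ i, x i ∈ Set.Icc (a i) (b i)} := by
    have h : IsCompact ((EuclideanSpace.equiv (Fin n) ℝ).toHomeomorph ⁻¹' Set.Icc a b) :=
      (EuclideanSpace.equiv (Fin n) ℝ).toHomeomorph.isCompact_preimage.2 isCompact_Icc
    exact h.isBounded.subset fun x hx => ⟨fun i => (hx i).1, fun i => (hx i).2⟩
  have hconv : Convex ℝ 𝒳 := by
    rw [h𝒳]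
    intro y hy z hz s t hs ht hst i
    exact convex_Icc (a i) (b i) (hy i) (hz i) hs ht hst
  obtain ⟨D, hD⟩ : ∃ D, ∀ y ∈ 𝒳, ∀ z ∈ 𝒳, ‖y - z‖ ≤ D := by
    obtain ⟨D, hD⟩ := Metric.isBounded_iff.1 (h𝒳 ▸ hbdd)
    exact ⟨D, fun y hy z hz => dist_eq_norm y z ▸ hD hy hz⟩
  have hD0 : 0 ≤ D := (norm_nonneg _).trans (hD _ hx0 _ hx0)
  have hPc' : ∀ q ∈ Pc, q ∈ (fun x => -G₀ x) '' interior 𝒳 := fun q hq => (hPc ▸ hq).1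
  have hstarX : ∀ q ∈ Pc, xstar q ∈ 𝒳 := fun q hq => interior_subset (hmaps (hPc' q hq))
  have hstar : ∀ q ∈ Pc, ∀ r ∈ Pc, ‖xstar q - xstar r‖ ≤ 2 / m * ‖q - r‖ := by
    intro q hq r hr
    have h := le_inner_sub_of_hasFDerivAt hconv (fun y hy => hG₀ y (hXU hy)) (c := m / 2)
      (fun y hy w => by rw [← inner_symCLM_self]; exact hsym y hy w) (hstarX q hq) (hstarX r hr)
    rw [hinv₁ q (hPc' q hq), hinv₁ r (hPc' r hr)] at h
    have h2 := real_inner_le_norm (xstar q - xstar r) (-q - -r)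
    rw [show -q - -r = -(q - r) by abel, norm_neg] at h2
    rw [show -q - -r = -(q - r) by abel] at h
    rcases (norm_nonneg (xstar q - xstar r)).eq_or_lt with h0 | h0
    · rw [← h0]; positivity
    · rw [div_mul_eq_mul_div, le_div_iff₀ hm]
      nlinarith
  have hpPc : ∀ k, p k ∈ Pc := by
    intro k
    induction k with
    | zero => exact hp0
    | succ k ih =>
      rw [hprec]
      by_cases h : p k + βk k • gradΦ (x k) ∈ Pc
      · rwa [Set.indicator_of_mem h]
      · rwa [Set.indicator_of_notMem h, add_zero]
  have hxX : ∀ k, x k ∈ 𝒳 := by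
    intro k
    induction k with
    | zero => exact hx0
    | succ k ih =>
      rw [hxrec]
      exact hconv.add_smul_sub_mem ih (hfmaps _ ih _ (hpPc k)) ⟨(hak k).1.le, (hak k).2⟩
  obtain ⟨M, hM0, hM⟩ : ∃ M, 0 ≤ M ∧ ∀ y ∈ 𝒳, ‖gradΦ y‖ ≤ M := by
    refine ⟨‖gradΦ (x 0)‖ + L₂ * D, by positivity, fun y hy => ?_⟩
    have h := hΦlip.norm_sub_le hy hx0
    have h1 := hD _ hy _ hx0
    have h2 := norm_le_norm_add_norm_sub' (gradΦ y) (gradΦ (x 0))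
    have h3 : (L₂ : ℝ) * ‖y - x 0‖ ≤ L₂ * D := by gcongr
    linarith
  have hpstep : ∀ k, ‖p (k + 1) - p k‖ ≤ M * βk k := by
    intro k
    rw [hprec, add_sub_cancel_left]
    refine (norm_indicator_le_norm_self _ _).trans ?_
    rw [norm_smul, Real.norm_of_nonneg (hbk k).le, mul_comm]
    exact mul_le_mul_of_nonneg_right (hM _ (hxX k)) (hbk k).le
  have hflip' : ∀ y ∈ 𝒳, ∀ z ∈ 𝒳, ∀ q ∈ Pc, ∀ r ∈ Pc,
      ‖f y q - f z r‖ ≤ Lf * max ‖y - z‖ ‖q - r‖ := by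
    intro y hy z hz q hq r hr
    exact hflip.norm_sub_le (x := (y, q)) (y := (z, r)) ⟨hy, hq⟩ ⟨hz, hr⟩
  have ha0 : Tendsto ak atTop (𝓝 0) := by
    have h : Tendsto (fun k => ak k ^ 2) atTop (𝓝 0) :=
      squeeze_zero (fun k => sq_nonneg _) (fun k => le_add_of_nonneg_right (sq_nonneg _))
        hsq.tendsto_atTop_zero
    have h2 := h.sqrt
    rw [Real.sqrt_zero] at h2
    exact h2.congr fun k => Real.sqrt_sq (hak k).1.le
  refine tendsto_order.2 ⟨fun ε hε => Eventually.of_forall fun k => hε.trans_le (norm_nonneg _),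
    fun ε hε => ?_⟩
  obtain ⟨T, hφT, hT⟩ : ∃ T, φ D T < ε / 2 ∧ 0 < T :=
    (((hφ.2.2 D hD0).2.eventually_lt_const (half_pos hε)).and (eventually_gt_atTop 0)).exists
  set B : ℝ := Lf * (M * (T + 1))
  set Q : ℝ := (B + (Lf + 1) * D) * (T + 1) * Real.exp ((Lf + 1) * (T + 1)) +
    2 / m * (M * (T + 1)) with hQ
  have hQ0 : 0 ≤ Q := by positivity
  obtain ⟨η, hη0, hηQ⟩ : ∃ η : ℝ, 0 < η ∧ Q * η < ε / 2 := by
    refine ⟨ε / 2 / (Q + 1), by positivity, ?_⟩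
    rw [mul_div_assoc', div_lt_iff₀ (by positivity)]
    nlinarith
  obtain ⟨K, hK⟩ := eventually_atTop.1
    ((ha0.eventually_le_const hη0).and (hratio.eventually_le_const hη0))
  filter_upwards [eventually_exists_sum_mem_Icc hak haksum K hT]
  rintro _ ⟨k, N, hKk, rfl, hS⟩
  set S := ∑ i ∈ Finset.range N, ak (k + i)
  have hdrift : ∀ j ≤ N, ‖p (k + j) - p k‖ ≤ M * (T + 1) * η := by
    intro j hj
    calc ‖p (k + j) - p k‖ = ‖∑ i ∈ Finset.range j, (p (k + (i + 1)) - p (k + i))‖ := by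
          rw [Finset.sum_range_sub fun i => p (k + i), add_zero]
      _ ≤ ∑ i ∈ Finset.range j, M * η * ak (k + i) := by
          refine norm_sum_le_of_le _ fun i _ => (hpstep (k + i)).trans ?_
          rw [mul_assoc]
          gcongr
          exact (div_le_iff₀ (hak (k + i)).1).1 (hK (k + i) (by omega)).2
      _ = M * η * ∑ i ∈ Finset.range j, ak (k + i) := by rw [Finset.mul_sum]
      _ ≤ M * η * (T + 1) := by
          gcongr
          refine le_trans ?_ hS.2
          exact Finset.sum_le_sum_of_subset_of_nonneg (Finset.range_mono hj)
            fun i _ _ => (hak _).1.le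
      _ = _ := by ring
  have hFlip : ∀ y ∈ 𝒳, ∀ z ∈ 𝒳, ‖f y (p k) - f z (p k)‖ ≤ Lf * ‖y - z‖ := fun y hy z hz => by
    simpa using hflip' y hy z hz _ (hpPc k) _ (hpPc k)
  obtain ⟨ξ, hξ0, hξX, hξ⟩ := exists_forall_hasDerivAt_box (a := a) (b := b)
    (F := fun y => f y (p k)) (K := Lf) (x₀ := x k)
    (fun y hy => by
      have h := hfmaps y (by rw [h𝒳]; exact hy) _ (hpPc k)
      rw [h𝒳] at h
      exact h)
    (by
      rw [← h𝒳]
      exact LipschitzOnWith.of_dist_le_mul fun y hy z hz => by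
        simpa only [dist_eq_norm] using hFlip y hy z hz)
    hbdd (by have h := hxX k; rw [h𝒳] at h; exact h)
  replace hξX : ∀ t, 0 ≤ t → ξ t ∈ 𝒳 := fun t ht => by rw [h𝒳]; exact hξX t ht
  have hS0 : 0 ≤ S := hT.le.trans hS.1
  have h1 : ‖x (k + N) - ξ S‖ ≤
      (B + (Lf + 1) * D) * η * (T + 1) * Real.exp ((Lf + 1) * (T + 1)) := by
    refine (norm_sub_perturbed_euler_le (x := fun j => x (k + j)) (B := B) (η := η)
      (u := fun j => f (x (k + j)) (p (k + j))) (α := fun j => ak (k + j)) Lf.coe_nonneg (by positivity)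
      hη0.le hD (fun y hy => hfmaps y hy _ (hpPc k)) hFlip hξX hξ (fun j => hxX _) hξ0.symm
      (fun j => hxrec _) (fun j => (hak _).1.le) (fun j => (hK _ (by omega)).1)
      (fun j hj => ?_)).trans ?_
    · refine (hflip' _ (hxX _) _ (hxX _) _ (hpPc _) _ (hpPc k)).trans ?_
      rw [sub_self, norm_zero, max_eq_right (norm_nonneg _), mul_assoc]
      gcongr
      exact hdrift j hj.le
    · gcongr
      exacts [hS.2, hS.2]
  have h2 : ‖ξ S - xstar (p k)‖ ≤ φ D T := by
    refine (hKL _ (hpPc k) ξ (hξX 0 le_rfl) hξ S hS0).trans ?_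
    exact ((hφ.2.1 S hS0).2.1.monotoneOn (norm_nonneg _) hD0
      (hD _ (hξX 0 le_rfl) _ (hstarX _ (hpPc k)))).trans ((hφ.2.2 D hD0).1 hT.le hS0 hS.1)
  have h3 : ‖xstar (p k) - xstar (p (k + N))‖ ≤ 2 / m * (M * (T + 1) * η) := by
    rw [norm_sub_rev]
    refine (hstar _ (hpPc _) _ (hpPc k)).trans ?_
    gcongr
    exact hdrift N le_rfl
  calc ‖x (k + N) - xstar (p (k + N))‖
      ≤ ‖x (k + N) - ξ S‖ + ‖ξ S - xstar (p k)‖ + ‖xstar (p k) - xstar (p (k + N))‖ := by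
        refine (norm_sub_le_norm_sub_add_norm_sub _ (xstar (p k)) _).trans ?_
        gcongr
        exact norm_sub_le_norm_sub_add_norm_sub _ _ _
    _ ≤ Q * η + φ D T := by rw [hQ]; linarith
    _ < ε := by linarith
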